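/- Let m, n be integers with gcd(m, n) = 1, and let Δ ⊆ ℝ³ be the convex hull of {(0,0,0), m·ζ − n·η, n·ζ + (m − n)·η}. Then for every positive integer t, the number of points of ℤ³ lying in tΔ equals (d·(m² − mn + n²)·t² + (gcd(m, d) + gcd(n, d) + gcd(m − n, d))·t)/2 + 1. -/

import Mathlib

open Pointwise

/-- The closed segment from `0` to `(a, b)` contains `gcd a b + 1` lattice points. -/
theorem ncard_lattice_segment (a b c e : ℤ) (hD : 0 < a * e - b * c) :
    {p : ℤ × ℤ | a * p.2 - b * p.1 = 0 ∧ 0 ≤ p.1 * e - p.2 * c ∧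
      p.1 * e - p.2 * c ≤ a * e - b * c}.ncard = Int.gcd a b + 1 := by
  have hg : 0 < Int.gcd a b := by
    rw [Int.gcd_pos_iff]
    by_contra! h
    simp [h.1, h.2] at hD
  obtain ⟨a', ha⟩ := Int.gcd_dvd_left a b
  obtain ⟨b', hb⟩ := Int.gcd_dvd_right a b
  have hbez := Int.gcd_eq_gcd_ab a b
  set g : ℤ := (Int.gcd a b : ℤ) with hgdef
  set u := Int.gcdA a b
  set v := Int.gcdB a b
  have hg' : 0 < g := Int.natCast_pos.mpr hg
  have hone : a' * u + b' * v = 1 := by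
    apply mul_left_cancel₀ hg'.ne'
    linear_combination -hbez - u * ha - v * hb
  have hq : 0 < a' * e - b' * c := by
    refine pos_of_mul_pos_right (a := g) ?_ hg'.le
    have : g * (a' * e - b' * c) = a * e - b * c := by
      linear_combination -e * ha + c * hb
    rwa [this]
  have himg : {p : ℤ × ℤ | a * p.2 - b * p.1 = 0 ∧ 0 ≤ p.1 * e - p.2 * c ∧
      p.1 * e - p.2 * c ≤ a * e - b * c} =
      (fun x : ℤ => (a' * x, b' * x)) '' (Finset.Icc 0 g : Finset ℤ) := by
    ext ⟨x, y⟩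
    simp only [Set.mem_ofPred_eq, Set.mem_image, Finset.coe_Icc, Set.mem_Icc, Prod.mk.injEq]
    constructor
    · rintro ⟨h1, h2, h3⟩
      have h4 : a' * y - b' * x = 0 := by
        apply mul_left_cancel₀ hg'.ne'
        linear_combination h1 - y * ha + x * hb
      have hx : a' * (u * x + v * y) = x := by linear_combination x * hone + v * h4
      have hy : b' * (u * x + v * y) = y := by linear_combination y * hone - u * h4
      have hs : x * e - y * c = (u * x + v * y) * (a' * e - b' * c) := by
        linear_combination -e * hx + c * hy
      have hD' : a * e - b * c = g * (a' * e - b' * c) := by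
        linear_combination e * ha - c * hb
      rw [hs] at h2 h3
      rw [hD'] at h3
      exact ⟨u * x + v * y, ⟨nonneg_of_mul_nonneg_left h2 hq, le_of_mul_le_mul_right h3 hq⟩, hx, hy⟩
    · rintro ⟨w, ⟨h0, h1⟩, rfl, rfl⟩
      refine ⟨by linear_combination b' * w * ha - a' * w * hb, ?_, ?_⟩
      · nlinarith [mul_nonneg h0 hq.le]
      · have hD' : a * e - b * c = g * (a' * e - b' * c) := by
          linear_combination e * ha - c * hb
        rw [hD']
        nlinarith [mul_le_mul_of_nonneg_right h1 hq.le]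
  rw [himg, Set.ncard_image_of_injective, Set.ncard_coe_finset, Int.card_Icc]
  · omega
  · intro x y hxy
    simp only [Prod.mk.injEq] at hxy
    linear_combination (y - x) * hone + u * hxy.1 + v * hxy.2

/-- A half-open lattice parallelogram contains as many lattice points as its area. -/
theorem ncard_lattice_parallelogram (a b c e : ℤ) (hD : 0 < a * e - b * c) :
    ({p : ℤ × ℤ | (0 ≤ a * p.2 - b * p.1 ∧ a * p.2 - b * p.1 < a * e - b * c) ∧
      0 ≤ p.1 * e - p.2 * c ∧ p.1 * e - p.2 * c < a * e - b * c}.ncard : ℤ) =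
      a * e - b * c := by
  have hg : 0 < Int.gcd a b := by
    rw [Int.gcd_pos_iff]
    by_contra! h
    simp [h.1, h.2] at hD
  obtain ⟨a', ha⟩ := Int.gcd_dvd_left a b
  obtain ⟨b', hb⟩ := Int.gcd_dvd_right a b
  have hbez := Int.gcd_eq_gcd_ab a b
  set g : ℤ := (Int.gcd a b : ℤ) with hgdef
  set u := Int.gcdA a b
  set v := Int.gcdB a b
  have hg' : 0 < g := Int.natCast_pos.mpr hg
  have hone : a' * u + b' * v = 1 := by
    apply mul_left_cancel₀ hg'.ne'
    linear_combination -hbez - u * ha - v * hb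
  obtain ⟨q, hqdef⟩ : ∃ q, q = a' * e - b' * c := ⟨_, rfl⟩
  have hD' : a * e - b * c = g * q := by
    linear_combination e * ha - c * hb - g * hqdef
  rw [hD'] at hD ⊢
  have hq : 0 < q := pos_of_mul_pos_right hD hg'.le
  obtain ⟨s, hs⟩ : ∃ s, s = u * c + v * e := ⟨_, rfl⟩
  have himg : {p : ℤ × ℤ | (0 ≤ a * p.2 - b * p.1 ∧ a * p.2 - b * p.1 < g * q) ∧
      0 ≤ p.1 * e - p.2 * c ∧ p.1 * e - p.2 * c < g * q} =
      (fun z : ℤ × ℤ => (a' * (z.1 - (-(z.2 * s)) / q) - v * z.2,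
        b' * (z.1 - (-(z.2 * s)) / q) + u * z.2)) ''
        (Finset.Ico 0 g ×ˢ Finset.Ico 0 q : Finset (ℤ × ℤ)) := by
    ext ⟨x, y⟩
    simp only [Set.mem_ofPred_eq, Set.mem_image, Finset.coe_product, Finset.coe_Ico, Set.mem_prod,
      Set.mem_Ico, Prod.mk.injEq, Prod.exists]
    constructor
    · rintro ⟨⟨h1, h2⟩, h3, h4⟩
      have hr : a * y - b * x = g * (a' * y - b' * x) := by
        linear_combination y * ha - x * hb
      rw [hr] at h1 h2
      obtain ⟨k, hk⟩ : ∃ k, k = a' * y - b' * x := ⟨_, rfl⟩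
      obtain ⟨w, hw⟩ : ∃ w, w = u * x + v * y := ⟨_, rfl⟩
      rw [← hk] at h1 h2
      have hx : x = a' * w - v * k := by rw [hw, hk]; linear_combination -x * hone
      have hy : y = b' * w + u * k := by rw [hw, hk]; linear_combination -y * hone
      have hxe : x * e - y * c = w * q - k * s := by
        rw [hx, hy, hqdef, hs]; ring
      rw [hxe] at h3 h4
      have hdiv := Int.emod_add_mul_ediv (-(k * s)) q
      have hm0 := Int.emod_nonneg (-(k * s)) hq.ne'
      have hm1 := Int.emod_lt_of_pos (-(k * s)) hq
      refine ⟨w + (-(k * s)) / q, k, ⟨⟨?_, ?_⟩, ?_, ?_⟩, ?_, ?_⟩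
      · have : 0 < (w + (-(k * s)) / q + 1) * q := by nlinarith
        have := pos_of_mul_pos_left this hq.le
        omega
      · have : (w + (-(k * s)) / q) * q < g * q := by nlinarith
        exact lt_of_mul_lt_mul_right this hq.le
      · exact nonneg_of_mul_nonneg_right h1 hg'
      · exact lt_of_mul_lt_mul_left h2 hg'.le
      · rw [hx]; ring
      · rw [hy]; ring
    · rintro ⟨i, k, ⟨⟨hi0, hi1⟩, hk0, hk1⟩, rfl, rfl⟩
      have hdiv := Int.emod_add_mul_ediv (-(k * s)) q
      have hm0 := Int.emod_nonneg (-(k * s)) hq.ne'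
      have hm1 := Int.emod_lt_of_pos (-(k * s)) hq
      generalize (-(k * s)) / q = f at *
      generalize (-(k * s)) % q = z at *
      have hr : a * (b' * (i - f) + u * k) - b * (a' * (i - f) - v * k) = g * k := by
        linear_combination (b' * (i - f) + u * k) * ha - (a' * (i - f) - v * k) * hb
          + g * k * hone
      have hs' : (a' * (i - f) - v * k) * e - (b' * (i - f) + u * k) * c = i * q + z := by
        linear_combination -(i - f) * hqdef + k * hs - hdiv
      rw [hr, hs']
      refine ⟨⟨by positivity, by gcongr⟩, by positivity, ?_⟩
      have : i + 1 ≤ g := hi1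
      nlinarith
  rw [himg, Set.ncard_image_of_injective, Set.ncard_coe_finset, Finset.card_product,
    Int.card_Ico, Int.card_Ico]
  · push_cast
    rw [sub_zero, sub_zero, Int.toNat_of_nonneg hg'.le, Int.toNat_of_nonneg hq.le]
  · rintro ⟨i, k⟩ ⟨j, l⟩ h
    simp only [Prod.mk.injEq] at h ⊢
    obtain ⟨h1, h2⟩ := h
    have hkl : k = l := by
      linear_combination (l - k) * hone + a' * h2 - b' * h1
    subst hkl
    refine ⟨?_, rfl⟩
    linear_combination (j - i) * hone + u * h1 + v * h2

/-- Pick's theorem for the lattice triangle with vertices `0`, `(a, b)` and `(c, e)`. -/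
theorem two_mul_ncard_lattice_triangle (a b c e : ℤ) (hD : 0 < a * e - b * c) :
    2 * ({p : ℤ × ℤ | 0 ≤ a * p.2 - b * p.1 ∧ 0 ≤ p.1 * e - p.2 * c ∧
      (a * p.2 - b * p.1) + (p.1 * e - p.2 * c) ≤ a * e - b * c}.ncard : ℤ) =
      (a * e - b * c) + Int.gcd a b + Int.gcd c e + Int.gcd (c - a) (e - b) + 2 := by
  have hP := ncard_lattice_parallelogram a b c e hD
  have hS1 := ncard_lattice_segment a b c e hD
  have hS2 := ncard_lattice_segment c e (-a) (-b) (by linarith)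
  have hS3 := ncard_lattice_segment (c - a) (e - b) (-a) (-b) (by linarith)
  set T := {p : ℤ × ℤ | 0 ≤ a * p.2 - b * p.1 ∧ 0 ≤ p.1 * e - p.2 * c ∧
      (a * p.2 - b * p.1) + (p.1 * e - p.2 * c) ≤ a * e - b * c} with hT
  set P := {p : ℤ × ℤ | (0 ≤ a * p.2 - b * p.1 ∧ a * p.2 - b * p.1 < a * e - b * c) ∧
      0 ≤ p.1 * e - p.2 * c ∧ p.1 * e - p.2 * c < a * e - b * c} with hPdef
  let T' := {p : ℤ × ℤ | a * p.2 - b * p.1 ≤ a * e - b * c ∧ p.1 * e - p.2 * c ≤ a * e - b * c ∧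
      a * e - b * c ≤ (a * p.2 - b * p.1) + (p.1 * e - p.2 * c)}
  let E1 := {p : ℤ × ℤ | a * p.2 - b * p.1 = a * e - b * c ∧ 0 ≤ p.1 * e - p.2 * c ∧
      p.1 * e - p.2 * c ≤ a * e - b * c}
  let E2 := {p : ℤ × ℤ | p.1 * e - p.2 * c = a * e - b * c ∧ 0 ≤ a * p.2 - b * p.1 ∧
      a * p.2 - b * p.1 ≤ a * e - b * c}
  let E3 := {p : ℤ × ℤ | (a * p.2 - b * p.1) + (p.1 * e - p.2 * c) = a * e - b * c ∧
      0 ≤ a * p.2 - b * p.1 ∧ a * p.2 - b * p.1 ≤ a * e - b * c}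
  have hE1 : E1.ncard = Int.gcd a b + 1 := by
    rw [← hS1]
    refine (congrArg Set.ncard ?_).trans
      (Set.ncard_image_of_injective _ (add_left_injective ((c, e) : ℤ × ℤ)))
    ext ⟨x, y⟩
    simp only [E1, Set.mem_ofPred_eq, Set.image_add_right, Set.mem_preimage, Prod.neg_mk,
      Prod.mk_add_mk]
    constructor
    · rintro ⟨h1, h2, h3⟩
      exact ⟨by linarith, by linarith, by linarith⟩
    · rintro ⟨h1, h2, h3⟩
      exact ⟨by linarith, by linarith, by linarith⟩
  have hE2 : E2.ncard = Int.gcd c e + 1 := by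
    rw [← hS2]
    refine (congrArg Set.ncard ?_).trans
      (Set.ncard_image_of_injective _ (add_left_injective ((a, b) : ℤ × ℤ)))
    ext ⟨x, y⟩
    simp only [E2, Set.mem_ofPred_eq, Set.image_add_right, Set.mem_preimage, Prod.neg_mk,
      Prod.mk_add_mk]
    constructor
    · rintro ⟨h1, h2, h3⟩
      exact ⟨by linarith, by linarith, by linarith⟩
    · rintro ⟨h1, h2, h3⟩
      exact ⟨by linarith, by linarith, by linarith⟩
  have hE3 : E3.ncard = Int.gcd (c - a) (e - b) + 1 := by
    rw [← hS3]
    refine (congrArg Set.ncard ?_).trans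
      (Set.ncard_image_of_injective _ (add_left_injective ((a, b) : ℤ × ℤ)))
    ext ⟨x, y⟩
    simp only [E3, Set.mem_ofPred_eq, Set.image_add_right, Set.mem_preimage, Prod.neg_mk,
      Prod.mk_add_mk]
    constructor
    · rintro ⟨h1, h2, h3⟩
      exact ⟨by linarith, by linarith, by linarith⟩
    · rintro ⟨h1, h2, h3⟩
      exact ⟨by linarith, by linarith, by linarith⟩
  have hT' : T'.ncard = T.ncard := by
    rw [← Set.ncard_image_of_injective T (sub_right_injective (b := ((a + c, b + e) : ℤ × ℤ)))]
    congr 1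
    ext ⟨x, y⟩
    simp only [T', hT, Set.mem_ofPred_eq, Set.mem_image, Prod.exists, Prod.mk_sub_mk, Prod.mk.injEq]
    constructor
    · rintro ⟨h1, h2, h3⟩
      exact ⟨a + c - x, b + e - y, ⟨by linarith, by linarith, by linarith⟩, by ring, by ring⟩
    · rintro ⟨x', y', ⟨h1, h2, h3⟩, rfl, rfl⟩
      exact ⟨by linarith, by linarith, by linarith⟩
  have hE12 : E1 ∩ E2 = {(a + c, b + e)} := by
    ext ⟨x, y⟩
    simp only [E1, E2, Set.mem_inter_iff, Set.mem_ofPred_eq, Set.mem_singleton_iff, Prod.mk.injEq]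
    constructor
    · rintro ⟨⟨h1, -, -⟩, h2, -, -⟩
      constructor
      · apply mul_left_cancel₀ hD.ne'
        linear_combination a * h2 + c * h1
      · apply mul_left_cancel₀ hD.ne'
        linear_combination b * h2 + e * h1
    · rintro ⟨rfl, rfl⟩
      exact ⟨⟨by ring, by linarith, by linarith⟩, by ring, by linarith, by linarith⟩
  have hPfin : P.Finite := Set.finite_of_ncard_ne_zero (by omega)
  have hE1fin : E1.Finite := Set.finite_of_ncard_ne_zero (by omega)
  have hE2fin : E2.Finite := Set.finite_of_ncard_ne_zero (by omega)
  have hE := Set.ncard_union_add_ncard_inter E1 E2 hE1fin hE2fin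
  rw [hE12, Set.ncard_singleton] at hE
  have hdisj : Disjoint P (E1 ∪ E2) := by
    rw [Set.disjoint_left]
    rintro ⟨x, y⟩ ⟨⟨h1, h2⟩, h3, h4⟩ (⟨h5, -, -⟩ | ⟨h5, -, -⟩)
    · exact h2.ne h5
    · exact h4.ne h5
  have hPE := Set.ncard_union_eq hdisj hPfin (hE1fin.union hE2fin)
  have hTT' : T ∪ T' = P ∪ (E1 ∪ E2) := by
    ext ⟨x, y⟩
    simp only [hT, T', hPdef, E1, E2, Set.mem_union, Set.mem_ofPred_eq]
    generalize a * y - b * x = r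
    generalize x * e - y * c = s
    generalize a * e - b * c = D at hD
    omega
  have hTiT' : T ∩ T' = E3 := by
    ext ⟨x, y⟩
    simp only [hT, T', E3, Set.mem_inter_iff, Set.mem_ofPred_eq]
    generalize a * y - b * x = r
    generalize x * e - y * c = s
    generalize a * e - b * c = D at hD
    omega
  have hfin : (T ∪ T').Finite := hTT' ▸ hPfin.union (hE1fin.union hE2fin)
  have hfinal := Set.ncard_union_add_ncard_inter T T' (hfin.subset Set.subset_union_left)
    (hfin.subset Set.subset_union_right)
  rw [hTT', hTiT'] at hfinal
  omega

theorem mem_convexHull_zero_pair {E : Type*} [AddCommGroup E] [Module ℝ E] (u v x : E) :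
    x ∈ convexHull ℝ {0, u, v} ↔
      ∃ α β : ℝ, 0 ≤ α ∧ 0 ≤ β ∧ α + β ≤ 1 ∧ α • u + β • v = x := by
  rw [convexHull_insert (by simp), convexHull_pair, mem_convexJoin]
  simp only [Set.mem_singleton_iff, exists_eq_left]
  constructor
  · rintro ⟨y, ⟨p, q, hp, hq, hpq, rfl⟩, r, s, hr, hs, hrs, rfl⟩
    refine ⟨s * p, s * q, by positivity, by positivity, ?_, ?_⟩
    · rw [← mul_add, hpq]; linarith
    · simp [mul_smul]
  · rintro ⟨α, β, hα, hβ, hαβ, rfl⟩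
    rcases (add_nonneg hα hβ).eq_or_lt with h | h
    · have h1 : α = 0 := by linarith
      have h2 : β = 0 := by linarith
      subst h1 h2
      exact ⟨u, left_mem_segment ℝ u v, by simpa using left_mem_segment ℝ 0 u⟩
    · refine ⟨(α / (α + β)) • u + (β / (α + β)) • v,
        ⟨α / (α + β), β / (α + β), by positivity, by positivity, by field_simp, rfl⟩,
        1 - (α + β), α + β, by linarith, h.le, by ring, ?_⟩
      rw [smul_zero, zero_add, smul_add, smul_smul, smul_smul, mul_div_cancel₀ _ h.ne',
        mul_div_cancel₀ _ h.ne']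

theorem stmt_19 (a c d : ℤ) (hd : 1 ≤ d)
    (hgcd : Int.gcd a c = 1) (heq : 2 * a ^ 2 + c ^ 2 = 3 * d ^ 2)
    (hcodd : Odd c) (hdodd : Odd d)
    (ζ η : Fin 3 → ℤ)
    (hζ : ζ = ![-(d + c) / 2, (d - c) / 2, a])
    (hη : η = ![(d - c) / 2, -(d + c) / 2, a])
    (m n : ℤ) (hmn : Int.gcd m n = 1)
    (Δ : Set (Fin 3 → ℝ))
    (hΔ : Δ = convexHull ℝ {0, (fun i => ((m • ζ - n • η) i : ℝ)),
                               (fun i => ((n • ζ + (m - n) • η) i : ℝ))})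
    (t : ℕ) (ht : 0 < t) :
    (({p : Fin 3 → ℤ | (fun i => (p i : ℝ)) ∈ (t : ℝ) • Δ}).ncard : ℚ) =
      ((d : ℚ) * ((m : ℚ) ^ 2 - (m : ℚ) * (n : ℚ) + (n : ℚ) ^ 2) * (t : ℚ) ^ 2 +
        ((Int.gcd m d : ℚ) + (Int.gcd n d : ℚ) + (Int.gcd (m - n) d : ℚ)) * (t : ℚ)) / 2
        + 1 := by
  have hc0 : c ≠ 0 := by rintro rfl; simp at hcodd
  have hcR : (c : ℝ) ≠ 0 := by exact_mod_cast hc0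
  have htZ : (0 : ℤ) < t := by exact_mod_cast ht
  have htR : (0 : ℝ) < t := by exact_mod_cast ht
  have hcop : IsCoprime m n := Int.isCoprime_iff_gcd_eq_one.mpr hmn
  have hQ : 0 < m ^ 2 - m * n + n ^ 2 := by
    have h0 : m ≠ 0 ∨ n ≠ 0 := by
      by_contra! h
      simp [h.1, h.2] at hmn
    rcases h0 with h0 | h0
    · have := sq_nonneg (2 * n - m)
      have := pow_pos (abs_pos.mpr h0) 2
      rw [sq_abs] at this
      nlinarith
    · have := sq_nonneg (2 * m - n)
      have := pow_pos (abs_pos.mpr h0) 2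
      rw [sq_abs] at this
      nlinarith
  have hdet : (t * (n * d)) * (t * m) - (t * (m - n)) * (t * ((n - m) * d)) =
      d * (m ^ 2 - m * n + n ^ 2) * (t : ℤ) ^ 2 := by ring
  have hdet0 : 0 < d * (m ^ 2 - m * n + n ^ 2) * (t : ℤ) ^ 2 := by positivity
  have hpick := two_mul_ncard_lattice_triangle (t * (n * d)) (t * (m - n))
    (t * ((n - m) * d)) (t * m) (hdet ▸ hdet0)
  have hg1 : Int.gcd (t * (n * d)) (t * (m - n)) = t * Int.gcd (m - n) d := by
    rw [Int.gcd_mul_left, Int.natAbs_natCast, Int.gcd_comm]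
    congr 1
    apply Int.gcd_mul_right_right_of_gcd_eq_one
    rw [← Int.isCoprime_iff_gcd_eq_one]
    simpa [sub_eq_add_neg] using hcop.add_mul_right_left (-1)
  have hg2 : Int.gcd (t * ((n - m) * d)) (t * m) = t * Int.gcd m d := by
    rw [Int.gcd_mul_left, Int.natAbs_natCast, Int.gcd_comm]
    congr 1
    apply Int.gcd_mul_right_right_of_gcd_eq_one
    rw [← Int.isCoprime_iff_gcd_eq_one]
    simpa [sub_eq_add_neg] using hcop.add_mul_left_right (-1)
  have hg3 : Int.gcd (t * ((n - m) * d) - t * (n * d)) (t * m - t * (m - n)) =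
      t * Int.gcd n d := by
    have h1 : t * ((n - m) * d) - t * (n * d) = t * (-m * d) := by ring
    have h2 : t * m - t * (m - n) = t * n := by ring
    rw [h1, h2, Int.gcd_mul_left, Int.natAbs_natCast, Int.gcd_comm]
    congr 1
    apply Int.gcd_mul_right_right_of_gcd_eq_one
    rw [← Int.isCoprime_iff_gcd_eq_one]
    exact hcop.symm.neg_right
  rw [hg1, hg2, hg3] at hpick
  have hζ0 : ζ 0 + ζ 1 = -c ∧ ζ 2 = a := by
    rw [hζ]
    simp only [Matrix.cons_val]
    obtain ⟨i, rfl⟩ := hcodd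
    obtain ⟨j, rfl⟩ := hdodd
    exact ⟨by omega, trivial⟩
  have hη0 : η 0 = ζ 0 + d ∧ η 1 = ζ 1 - d ∧ η 2 = a := by
    rw [hζ, hη]
    simp only [Matrix.cons_val]
    obtain ⟨i, rfl⟩ := hcodd
    obtain ⟨j, rfl⟩ := hdodd
    exact ⟨by omega, by omega, trivial⟩
  obtain ⟨hζs, hζ2⟩ := hζ0
  obtain ⟨hη0, hη1, hη2⟩ := hη0
  clear hζ hη
  have hζsR : (ζ 0 : ℝ) + ζ 1 = -c := by exact_mod_cast hζs
  have himg : {p : Fin 3 → ℤ | (fun i => (p i : ℝ)) ∈ (t : ℝ) • Δ} =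
      (fun z : ℤ × ℤ => (![-z.1 + z.2 * ζ 0, z.1 + z.2 * ζ 1, z.2 * a] : Fin 3 → ℤ)) ''
      {p : ℤ × ℤ | 0 ≤ (t * (n * d)) * p.2 - (t * (m - n)) * p.1 ∧
        0 ≤ p.1 * (t * m) - p.2 * (t * ((n - m) * d)) ∧
        ((t * (n * d)) * p.2 - (t * (m - n)) * p.1) +
          (p.1 * (t * m) - p.2 * (t * ((n - m) * d))) ≤
        (t * (n * d)) * (t * m) - (t * (m - n)) * (t * ((n - m) * d))} := by
    ext p
    rw [hdet]
    simp only [hΔ, Set.mem_ofPred_eq, Set.mem_smul_set, mem_convexHull_zero_pair, Set.mem_image,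
      Prod.exists]
    have hdetR : (0 : ℝ) < d * (m ^ 2 - m * n + n ^ 2) * (t : ℝ) ^ 2 := by exact_mod_cast hdet0
    have hqR : (0 : ℝ) < d * (m ^ 2 - m * n + n ^ 2) := by
      have : 0 < d * (m ^ 2 - m * n + n ^ 2) := by positivity
      exact_mod_cast this
    constructor
    · rintro ⟨_, ⟨α, β, hα, hβ, hαβ, rfl⟩, hp⟩
      have hp0 := congrFun hp 0
      have hp1 := congrFun hp 1
      have hp2 := congrFun hp 2
      simp only [Pi.smul_apply, Pi.add_apply, Pi.sub_apply, smul_eq_mul, hη0, hη1, hη2, hζ2]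
        at hp0 hp1 hp2
      push_cast at hp0 hp1 hp2
      have hplane : a * (p 0 + p 1) + c * p 2 = 0 := by
        have : (a : ℝ) * (p 0 + p 1) + c * p 2 = 0 := by
          rw [← hp0, ← hp1, ← hp2]
          linear_combination (a : ℝ) * t * (α * (m - n) + β * m) * hζsR
        exact_mod_cast this
      have hdvd : c ∣ p 0 + p 1 := by
        have : c ∣ a * (p 0 + p 1) := ⟨-p 2, by linarith⟩
        exact (Int.isCoprime_iff_gcd_eq_one.mpr hgcd).symm.dvd_of_dvd_mul_left this
      obtain ⟨k', hk'⟩ := hdvd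
      obtain ⟨k, rfl⟩ : ∃ k, k' = -k := ⟨-k', by ring⟩
      have hp2k : p 2 = k * a := by
        apply mul_left_cancel₀ hc0
        linear_combination hplane - a * hk'
      have hkR : (k : ℝ) = t * (α * (m - n) + β * m) := by
        apply mul_left_cancel₀ hcR
        have : (p 0 : ℝ) + p 1 = c * (-k) := by exact_mod_cast hk'
        rw [← hp0, ← hp1] at this
        linear_combination this - (t * (α * (m - n) + β * m)) * hζsR
      have hxR : ((p 1 - k * ζ 1 : ℤ) : ℝ) = t * (α * (n * d) + β * ((n - m) * d)) := by
        push_cast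
        rw [← hp1, hkR]
        ring
      refine ⟨p 1 - k * ζ 1, k, ⟨?_, ?_, ?_⟩, ?_⟩
      · have : (0 : ℝ) ≤ (t * (n * d)) * k - (t * (m - n)) * (p 1 - k * ζ 1 : ℤ) := by
          rw [hkR, hxR]
          have := mul_nonneg hβ hdetR.le
          linarith
        exact_mod_cast this
      · have : (0 : ℝ) ≤ (p 1 - k * ζ 1 : ℤ) * (t * m) - k * (t * ((n - m) * d)) := by
          rw [hkR, hxR]
          have := mul_nonneg hα hdetR.le
          linarith
        exact_mod_cast this
      · have : (t * (n * d)) * k - (t * (m - n)) * (p 1 - k * ζ 1 : ℤ) +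
            ((p 1 - k * ζ 1 : ℤ) * (t * m) - k * (t * ((n - m) * d))) ≤
            (d * (m ^ 2 - m * n + n ^ 2) * t ^ 2 : ℝ) := by
          rw [hkR, hxR]
          have := mul_le_mul_of_nonneg_right hαβ hdetR.le
          linarith
        exact_mod_cast this
      · funext i
        fin_cases i
        · simp only [Fin.zero_eta, Matrix.cons_val]
          linear_combination -hk' + k * hζs
        · simp
        · simp [hp2k]
    · rintro ⟨x, k, ⟨h1, h2, h3⟩, rfl⟩
      have h1R : (0 : ℝ) ≤ (t * (n * d)) * k - (t * (m - n)) * x := by exact_mod_cast h1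
      have h2R : (0 : ℝ) ≤ x * (t * m) - k * (t * ((n - m) * d)) := by exact_mod_cast h2
      have h3R : (t * (n * d)) * k - (t * (m - n)) * x +
          (x * (t * m) - k * (t * ((n - m) * d))) ≤
          (d * (m ^ 2 - m * n + n ^ 2) * t ^ 2 : ℝ) := by exact_mod_cast h3
      obtain ⟨D, hD⟩ : ∃ D : ℝ, D = d * (m ^ 2 - m * n + n ^ 2) * (t : ℝ) ^ 2 := ⟨_, rfl⟩
      rw [← hD] at hdetR h3R
      obtain ⟨α, hα⟩ : ∃ α : ℝ, α * D = x * (t * m) - k * (t * ((n - m) * d)) :=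
        ⟨_, div_mul_cancel₀ _ hdetR.ne'⟩
      obtain ⟨β, hβ⟩ : ∃ β : ℝ, β * D = (t * (n * d)) * k - (t * (m - n)) * x :=
        ⟨_, div_mul_cancel₀ _ hdetR.ne'⟩
      rw [← hβ] at h1R
      rw [← hα] at h2R
      rw [← hα, ← hβ, ← add_mul] at h3R
      have hx : t * (α * (n * d) + β * ((n - m) * d)) = (x : ℝ) := by
        apply mul_left_cancel₀ hdetR.ne'
        linear_combination (t * n * d) * hα + (t * (n - m) * d) * hβ - x * hD
      have hk : t * (α * (m - n) + β * m) = (k : ℝ) := by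
        apply mul_left_cancel₀ hdetR.ne'
        linear_combination (t * (m - n)) * hα + (t * m) * hβ - k * hD
      refine ⟨_, ⟨α, β, nonneg_of_mul_nonneg_left h2R hdetR,
        nonneg_of_mul_nonneg_left h1R hdetR, ?_, rfl⟩, ?_⟩
      · have : (β + α) * D ≤ 1 * D := by rwa [one_mul]
        linarith [le_of_mul_le_mul_right this hdetR]
      · funext i
        fin_cases i <;>
          simp only [Fin.zero_eta, Fin.mk_one, Fin.reduceFinMk, Pi.smul_apply, Pi.add_apply,
            Pi.sub_apply, smul_eq_mul, hη0, hη1, hη2, hζ2, Matrix.cons_val] <;>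
          push_cast
        · linear_combination -hx + ζ 0 * hk
        · linear_combination hx + ζ 1 * hk
        · linear_combination a * hk
  have hinj : Function.Injective
      (fun z : ℤ × ℤ => (![-z.1 + z.2 * ζ 0, z.1 + z.2 * ζ 1, z.2 * a] : Fin 3 → ℤ)) := by
    rintro ⟨x, k⟩ ⟨y, l⟩ h
    have h0 := congrFun h 0
    have h1 := congrFun h 1
    simp only [Matrix.cons_val] at h0 h1
    have hkl : k = l := by
      apply mul_left_cancel₀ hc0
      linear_combination -h0 - h1 + (k - l) * hζs
    subst hkl
    simp only [Prod.mk.injEq, and_true]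
    linarith
  rw [himg, Set.ncard_image_of_injective _ hinj]
  rw [hdet] at hpick ⊢
  have hpickQ := congrArg (Int.cast : ℤ → ℚ) hpick
  push_cast at hpickQ
  linear_combination hpickQ / 2
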